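/- arXiv:1905.03875 — 6 statements merged into one kernel-verified Lean document; each statement's English description precedes it below -/
import Mathlib

section
/- Let δ > 0 and let μ_δ be the triangular peridynamic kernel. Then for every real a ≠ 0 and every x ∈ ℝ, the function sin(a·x) is an eigenfunction of the peridynamic Laplacian: ∫_{-δ}^{δ} μ_δ(ξ)·(sin(a·(x+ξ)) - sin(a·x)) dξ = (24·(1 - cos(a·δ))/(a²·δ⁴) - 12/δ²)·sin(a·x). -/
open MeasureTheory intervalIntegral

/-- The triangular peridynamic kernel with horizon `δ`:
`μ_δ(ξ) = (12/δ³)·(1 - |ξ|/δ)` for `|ξ| ≤ δ` and `0` otherwise. -/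
noncomputable def triKernel (δ : ℝ) (ξ : ℝ) : ℝ :=
  if |ξ| ≤ δ then (12 / δ ^ 3) * (1 - |ξ| / δ) else 0

theorem integral_affine_mul_sin_sub (k c a x S u v : ℝ) (ha : a ≠ 0) :
    (∫ ξ in u..v, k * (1 - c * ξ) * (Real.sin (a * (x + ξ)) - S))
      = k * ((c * v - 1) * Real.cos (a * (x + v)) / a - c * Real.sin (a * (x + v)) / a ^ 2
            - S * (v - c * v ^ 2 / 2))
        - k * ((c * u - 1) * Real.cos (a * (x + u)) / a - c * Real.sin (a * (x + u)) / a ^ 2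
            - S * (u - c * u ^ 2 / 2)) := by
  refine integral_eq_sub_of_hasDerivAt (f := fun ξ ↦
    k * ((c * ξ - 1) * Real.cos (a * (x + ξ)) / a - c * Real.sin (a * (x + ξ)) / a ^ 2
      - S * (ξ - c * ξ ^ 2 / 2))) (fun ξ _ ↦ ?_)
    (Continuous.intervalIntegrable (by fun_prop) _ _)
  have hid := hasDerivAt_id' ξ
  have harg : HasDerivAt (fun ξ ↦ a * (x + ξ)) (a * 1) ξ := (hid.const_add x).const_mul a
  refine (((((((hid.const_mul c).sub_const 1).mul harg.cos).div_const a).sub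
    ((harg.sin.const_mul c).div_const (a ^ 2))).sub
    ((hid.sub (((hid.pow 2).const_mul c).div_const 2)).const_mul S)).const_mul k).congr_deriv ?_
  push_cast
  field_simp
  ring

/-- `sin(a·x)` is an eigenfunction of the peridynamic Laplacian with the
triangular kernel, with eigenvalue `24·(1-cos(aδ))/(a²δ⁴) - 12/δ²`. -/
theorem sin_eigenfunction_of_peridynamic_laplacian
    (δ : ℝ) (hδ : 0 < δ) (a : ℝ) (ha : a ≠ 0) (x : ℝ) :
    (∫ ξ in (-δ)..δ, triKernel δ ξ * (Real.sin (a * (x + ξ)) - Real.sin (a * x)))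
      = (24 * (1 - Real.cos (a * δ)) / (a ^ 2 * δ ^ 4) - 12 / δ ^ 2) * Real.sin (a * x) := by
  have hcongr : Set.EqOn
      (fun ξ ↦ triKernel δ ξ * (Real.sin (a * (x + ξ)) - Real.sin (a * x)))
      (fun ξ ↦ 12 / δ ^ 3 * (1 - |ξ| / δ) * (Real.sin (a * (x + ξ)) - Real.sin (a * x)))
      (Set.uIcc (-δ) δ) := by
    intro ξ hξ
    rw [Set.uIcc_of_le (by linarith)] at hξ
    simp only [triKernel, if_pos (abs_le.2 hξ)]
  have hint (u v : ℝ) : IntervalIntegrable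
      (fun ξ ↦ 12 / δ ^ 3 * (1 - |ξ| / δ) * (Real.sin (a * (x + ξ)) - Real.sin (a * x)))
      volume u v := Continuous.intervalIntegrable (by fun_prop) _ _
  have hneg : Set.EqOn
      (fun ξ ↦ 12 / δ ^ 3 * (1 - |ξ| / δ) * (Real.sin (a * (x + ξ)) - Real.sin (a * x)))
      (fun ξ ↦ 12 / δ ^ 3 * (1 - -δ⁻¹ * ξ) * (Real.sin (a * (x + ξ)) - Real.sin (a * x)))
      (Set.uIcc (-δ) 0) := by
    intro ξ hξ
    rw [Set.uIcc_of_le (by linarith)] at hξ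
    simp only [abs_of_nonpos hξ.2]
    ring
  have hpos : Set.EqOn
      (fun ξ ↦ 12 / δ ^ 3 * (1 - |ξ| / δ) * (Real.sin (a * (x + ξ)) - Real.sin (a * x)))
      (fun ξ ↦ 12 / δ ^ 3 * (1 - δ⁻¹ * ξ) * (Real.sin (a * (x + ξ)) - Real.sin (a * x)))
      (Set.uIcc 0 δ) := by
    intro ξ hξ
    rw [Set.uIcc_of_le hδ.le] at hξ
    simp only [abs_of_nonneg hξ.1]
    ring
  rw [integral_congr hcongr, ← integral_add_adjacent_intervals (hint (-δ) 0) (hint 0 δ),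
    integral_congr hneg, integral_congr hpos, integral_affine_mul_sin_sub _ _ _ _ _ _ _ ha,
    integral_affine_mul_sin_sub _ _ _ _ _ _ _ ha]
  simp only [mul_add, mul_neg, mul_zero, add_zero, Real.sin_add, Real.cos_add, Real.sin_neg,
    Real.cos_neg]
  field_simp
  ring
end

section
/- Let δ > 0 and let μ_δ be the triangular peridynamic kernel. Then for every real a ≠ 0 and every x ∈ ℝ, the function cos(a·x) is an eigenfunction of the peridynamic Laplacian: ∫_{-δ}^{δ} μ_δ(ξ)·(cos(a·(x+ξ)) - cos(a·x)) dξ = (24·(1 - cos(a·δ))/(a²·δ⁴) - 12/δ²)·cos(a·x). -/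
open MeasureTheory intervalIntegral

theorem triKernel_neg (δ ξ : ℝ) : triKernel δ (-ξ) = triKernel δ ξ := by
  simp only [triKernel, abs_neg]

theorem triKernel_of_mem_Icc {δ ξ : ℝ} (hξ : ξ ∈ Set.Icc 0 δ) :
    triKernel δ ξ = 12 / δ ^ 3 * (1 - ξ / δ) := by
  simp only [triKernel, abs_of_nonneg hξ.1, if_pos hξ.2]

theorem continuousOn_triKernel (δ : ℝ) : ContinuousOn (triKernel δ) (Set.Icc (-δ) δ) := by
  refine ContinuousOn.congr (f := fun ξ => 12 / δ ^ 3 * (1 - |ξ| / δ)) (by fun_prop) fun ξ hξ => ?_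
  simp only [triKernel, if_pos (abs_le.2 hξ)]

theorem integral_triKernel_mul_cos_sub {δ : ℝ} (hδ : 0 < δ) {a : ℝ} (ha : a ≠ 0) (x : ℝ) :
    (∫ ξ in (0 : ℝ)..δ, triKernel δ ξ * (Real.cos (a * (x + ξ)) - Real.cos (a * x)))
      = 12 / δ ^ 3 * (-Real.sin (a * x) / a
          + (Real.cos (a * x) - Real.cos (a * (x + δ))) / (a ^ 2 * δ)
          - Real.cos (a * x) * (δ / 2)) := by
  have hδ' := hδ.ne'
  have hcongr : Set.EqOn
      (fun ξ => triKernel δ ξ * (Real.cos (a * (x + ξ)) - Real.cos (a * x)))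
      (fun ξ => 12 / δ ^ 3 * (1 - ξ / δ) * (Real.cos (a * (x + ξ)) - Real.cos (a * x)))
      (Set.uIcc 0 δ) := by
    intro ξ hξ
    rw [Set.uIcc_of_le hδ.le] at hξ
    simp only [triKernel_of_mem_Icc hξ]
  have hderiv (ξ : ℝ) : HasDerivAt
      (fun ξ => 12 / δ ^ 3 * ((1 - ξ / δ) * (Real.sin (a * (x + ξ)) / a)
        - Real.cos (a * (x + ξ)) / (a ^ 2 * δ) - Real.cos (a * x) * (ξ - ξ ^ 2 / (2 * δ))))
      (12 / δ ^ 3 * (1 - ξ / δ) * (Real.cos (a * (x + ξ)) - Real.cos (a * x))) ξ := by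
    have hid := hasDerivAt_id' ξ
    have harg := (hid.const_add x).const_mul a
    refine HasDerivAt.congr_deriv (((((hid.div_const δ).const_sub 1).mul (harg.sin.div_const a)).sub
      (harg.cos.div_const (a ^ 2 * δ)) |>.sub
      ((hid.sub ((hid.pow 2).div_const (2 * δ))).const_mul (Real.cos (a * x)))).const_mul
      (12 / δ ^ 3)) ?_
    norm_num
    field_simp
    ring
  rw [integral_congr hcongr, integral_eq_sub_of_hasDerivAt (fun ξ _ => hderiv ξ)
    (Continuous.intervalIntegrable (by fun_prop) _ _), add_zero]
  field_simp
  ring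

/-- `cos(a·x)` is an eigenfunction of the peridynamic Laplacian with the
triangular kernel, with eigenvalue `24·(1-cos(aδ))/(a²δ⁴) - 12/δ²`. -/
theorem cos_eigenfunction_of_peridynamic_laplacian
    (δ : ℝ) (hδ : 0 < δ) (a : ℝ) (ha : a ≠ 0) (x : ℝ) :
    (∫ ξ in (-δ)..δ, triKernel δ ξ * (Real.cos (a * (x + ξ)) - Real.cos (a * x)))
      = (24 * (1 - Real.cos (a * δ)) / (a ^ 2 * δ ^ 4) - 12 / δ ^ 2) * Real.cos (a * x) := by
  have hint : IntervalIntegrable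
      (fun ξ => triKernel δ ξ * (Real.cos (a * (x + ξ)) - Real.cos (a * x))) volume (-δ) δ := by
    refine ContinuousOn.intervalIntegrable_of_Icc (by linarith) ?_
    exact (continuousOn_triKernel δ).mul (by fun_prop)
  have hzero : (0 : ℝ) ∈ Set.uIcc (-δ) δ := by
    rw [Set.mem_uIcc]
    exact Or.inl ⟨by linarith, hδ.le⟩
  have hleft : (∫ ξ in (-δ)..0, triKernel δ ξ * (Real.cos (a * (x + ξ)) - Real.cos (a * x)))
      = ∫ ξ in (0 : ℝ)..δ, triKernel δ ξ * (Real.cos (a * (-x + ξ)) - Real.cos (a * -x)) := by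
    rw [← neg_zero, ← integral_comp_neg, neg_zero]
    refine integral_congr fun ξ _ => ?_
    simp only [triKernel_neg]
    rw [← Real.cos_neg (a * (x + -ξ)), ← Real.cos_neg (a * x)]
    ring_nf
  rw [← integral_add_adjacent_intervals
      (hint.mono_set (Set.uIcc_subset_uIcc_left hzero))
      (hint.mono_set (Set.uIcc_subset_uIcc_right hzero)),
    hleft, integral_triKernel_mul_cos_sub hδ ha, integral_triKernel_mul_cos_sub hδ ha]
  simp only [mul_add, mul_neg, Real.cos_add, Real.cos_neg, Real.sin_neg]
  have hδ' := hδ.ne'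
  field_simp
  ring
end

section
/- Let ν > 0, L > 0, δ > 0, and let μ_δ be the triangular peridynamic kernel. Define u(x,t) = 2x/L + e^{-ν·t}·sin(2π·x/L) and f(x,t) = ν·{(6L²/(δ⁴·π²))·(cos(2π·δ/L) - 1) + 12/δ² - 1}·e^{-ν·t}·sin(2π·x/L). Then u solves the peridynamic diffusion equation: for all x ∈ ℝ and all t ∈ ℝ, ∂u/∂t (x,t) = ν·∫_{-δ}^{δ} μ_δ(ξ)·(u(x+ξ,t) - u(x,t)) dξ + f(x,t), where ∂u/∂t (x,t) denotes the derivative of the map t ↦ u(x,t). -/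
open MeasureTheory intervalIntegral

/-- Integration against the triangular kernel only sees the even part of the integrand. -/
lemma integral_triKernel_mul {δ : ℝ} (hδ : 0 < δ) {g : ℝ → ℝ} (hg : Continuous g) :
    ∫ ξ in (-δ)..δ, triKernel δ ξ * g ξ =
      ∫ ξ in (0 : ℝ)..δ, 12 / δ ^ 3 * (1 - ξ / δ) * (g ξ + g (-ξ)) := by
  set h : ℝ → ℝ := fun ξ => 12 / δ ^ 3 * (1 - |ξ| / δ) * g ξ with hh
  have hc : Continuous h := by fun_prop
  have h1 : ∫ ξ in (-δ)..δ, triKernel δ ξ * g ξ = ∫ ξ in (-δ)..δ, h ξ := by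
    refine integral_congr fun ξ hξ => ?_
    rw [Set.uIcc_of_le (by linarith)] at hξ
    simp [triKernel, hh, abs_le.2 hξ]
  have h2 : ∫ ξ in (-δ)..0, h ξ = ∫ ξ in (0 : ℝ)..δ, h (-ξ) := by
    rw [integral_comp_neg, neg_zero]
  rw [h1, ← integral_add_adjacent_intervals (hc.intervalIntegrable (-δ) 0)
    (hc.intervalIntegrable 0 δ), h2, ← intervalIntegral.integral_add
    ((by fun_prop : Continuous fun ξ => h (-ξ)).intervalIntegrable 0 δ) (hc.intervalIntegrable 0 δ)]
  refine integral_congr fun ξ hξ => ?_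
  rw [Set.uIcc_of_le hδ.le] at hξ
  simp only [hh, abs_neg, abs_of_nonneg hξ.1]
  ring

lemma integral_one_sub_div_mul_cos_sub_one {δ k : ℝ} (hδ : δ ≠ 0) (hk : k ≠ 0) :
    ∫ ξ in (0 : ℝ)..δ, (1 - ξ / δ) * (Real.cos (k * ξ) - 1) =
      (1 - Real.cos (k * δ)) / (δ * k ^ 2) - δ / 2 := by
  have hd : ∀ ξ ∈ Set.uIcc 0 δ, HasDerivAt
      (fun y => (1 - y / δ) * (Real.sin (k * y) / k) - Real.cos (k * y) / (δ * k ^ 2)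
        - y + y ^ 2 / (2 * δ))
      ((1 - ξ / δ) * (Real.cos (k * ξ) - 1)) ξ := by
    intro ξ _
    have hkξ : HasDerivAt (fun y : ℝ => k * y) k ξ := by
      simpa using (hasDerivAt_id ξ).const_mul k
    have h1 : HasDerivAt (fun y : ℝ => 1 - y / δ) (-(1 / δ)) ξ :=
      ((hasDerivAt_id ξ).div_const δ).const_sub 1
    have h := (((h1.mul (hkξ.sin.div_const k)).sub (hkξ.cos.div_const (δ * k ^ 2))).sub
      (hasDerivAt_id ξ)).add ((hasDerivAt_pow 2 ξ).div_const (2 * δ))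
    refine h.congr_deriv ?_
    field_simp
    push_cast
    ring
  rw [integral_eq_sub_of_hasDerivAt hd (Continuous.intervalIntegrable (by fun_prop) _ _)]
  simp only [mul_zero, Real.sin_zero, Real.cos_zero]
  field_simp
  ring

/-- `u(x,t) = 2x/L + e^{-νt} sin(2πx/L)` solves the peridynamic diffusion
equation `∂u/∂t = ν·L_δ u + f` with the manufactured source term `f`. -/
theorem manufactured_solution_dirichlet
    (ν L δ : ℝ) (hν : 0 < ν) (hL : 0 < L) (hδ : 0 < δ)
    (u f : ℝ → ℝ → ℝ)
    (hu : ∀ x t : ℝ, u x t = 2 * x / L + Real.exp (-ν * t) * Real.sin (2 * Real.pi * x / L))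
    (hf : ∀ x t : ℝ, f x t =
      ν * ((6 * L ^ 2 / (δ ^ 4 * Real.pi ^ 2)) * (Real.cos (2 * Real.pi * δ / L) - 1)
            + 12 / δ ^ 2 - 1) * Real.exp (-ν * t) * Real.sin (2 * Real.pi * x / L))
    (x t : ℝ) :
    HasDerivAt (fun s => u x s)
      (ν * (∫ ξ in (-δ)..δ, triKernel δ ξ * (u (x + ξ) t - u x t)) + f x t) t := by
  have hπ : Real.pi ≠ 0 := Real.pi_ne_zero
  have hg : Continuous fun ξ => u (x + ξ) t - u x t := by
    simp only [hu]
    fun_prop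
  have hI : ∫ ξ in (-δ)..δ, triKernel δ ξ * (u (x + ξ) t - u x t) =
      24 / δ ^ 3 * (Real.exp (-ν * t) * Real.sin (2 * Real.pi * x / L)) *
        ((1 - Real.cos (2 * Real.pi / L * δ)) / (δ * (2 * Real.pi / L) ^ 2) - δ / 2) := by
    rw [integral_triKernel_mul hδ hg,
      ← integral_one_sub_div_mul_cos_sub_one hδ.ne' (by positivity : 2 * Real.pi / L ≠ 0),
      ← intervalIntegral.integral_const_mul]
    refine integral_congr fun ξ _ => ?_
    have e1 : 2 * Real.pi * (x + ξ) / L = 2 * Real.pi * x / L + 2 * Real.pi / L * ξ := by ring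
    have e2 : 2 * Real.pi * (x + -ξ) / L = 2 * Real.pi * x / L - 2 * Real.pi / L * ξ := by ring
    simp only [hu, e1, e2, Real.sin_add, Real.sin_sub]
    ring
  have hexp : HasDerivAt (fun s => Real.exp (-ν * s)) (Real.exp (-ν * t) * -ν) t := by
    simpa using ((hasDerivAt_id t).const_mul (-ν)).exp
  simp only [hu x]
  refine ((hexp.mul_const (Real.sin (2 * Real.pi * x / L))).const_add (2 * x / L)).congr_deriv ?_
  simp only [← hu x]
  rw [hI, hf, show 2 * Real.pi / L * δ = 2 * Real.pi * δ / L by ring]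
  generalize Real.cos (2 * Real.pi * δ / L) = c
  generalize Real.sin (2 * Real.pi * x / L) = s
  generalize Real.exp (-ν * t) = e
  field_simp
  ring
end

section
/- Let δ ∈ ℝ, q_b ∈ ℝ, and let v : ℝ → ℝ be differentiable at δ. Suppose there exists η > 0 such that v(x) = -2·q_b·(δ - x) + v(2δ - x) for all x with δ - η < x < δ. Then v'(δ) = q_b. In other words, the fictitious-nodes even-reflection-plus-linear-term volume constraint enforces the local Neumann boundary condition v'(δ) = q_b at the boundary point δ. -/
/-- The fictitious-nodes even-reflection-plus-linear-term volume constraint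
enforces the local Neumann boundary condition: if `v` is differentiable at `δ`
and `v(x) = -2·q_b·(δ - x) + v(2δ - x)` for all `x` in a left neighborhood of
`δ`, then `v'(δ) = q_b`. -/
theorem fictitious_nodes_neumann
    (δ qb : ℝ) (v : ℝ → ℝ) (hv : DifferentiableAt ℝ v δ)
    (h : ∃ η : ℝ, 0 < η ∧ ∀ x : ℝ, δ - η < x → x < δ →
          v x = -2 * qb * (δ - x) + v (2 * δ - x)) :
    deriv v δ = qb := by
  obtain ⟨η, hη, h⟩ := h
  have hd : HasDerivAt v (deriv v δ) δ := hv.hasDerivAt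
  have hd' : HasDerivAt v (deriv v δ) (2 * δ - δ) := by
    rwa [show 2 * δ - δ = δ by ring]
  have hg : HasDerivAt (fun x => -2 * qb * (δ - x) + v (2 * δ - x))
      (-2 * qb * (-1) + -deriv v δ) δ :=
    (((hasDerivAt_id δ).const_sub δ).const_mul (-2 * qb)).add (hd'.comp_const_sub (2 * δ) δ)
  have heq : v =ᶠ[nhdsWithin δ (Set.Iio δ)] fun x => -2 * qb * (δ - x) + v (2 * δ - x) := by
    filter_upwards [Ioo_mem_nhdsLT (sub_lt_self δ hη)] with x hx using h x hx.1 hx.2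
  have hvδ : v δ = -2 * qb * (δ - δ) + v (2 * δ - δ) := by
    rw [show 2 * δ - δ = δ by ring]
    ring
  have huniq := (uniqueDiffWithinAt_Iio δ).eq_deriv _ hd.hasDerivWithinAt
    (hg.hasDerivWithinAt.congr_of_eventuallyEq heq hvδ)
  linarith
end

section
/- Let m ∈ ℕ, let (μ_p)_{p=-m,…,m} be real numbers with μ_{-p} = μ_p for all p, let ν, β, Δx, Δt, ε ∈ ℝ with ε ≠ 0, let χ ∈ ℝ, and let k ∈ ℝ. Define the Forward-Euler update of a grid function y : ℤ → ℂ by (G y)_i = y_i + Δt·(ν·∑_{p=-m}^{m} μ_p·y_{i+p}·Δx - ν·β·y_i - (χ/ε)·y_i). Then the complex exponential grid function e_i = e^{i·k·i·Δx} (i the imaginary unit in the exponent, i ∈ ℤ the grid index) is an eigenvector of G: for every i ∈ ℤ, (G e)_i = ρ·e_i with amplification factor ρ = 1 + Δt·(M - χ/ε), where M = ν·(∑_{p=-m}^{m} μ_p·cos(k·p·Δx)·Δx - β). In particular ρ is real. -/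
open Finset

/-- Summing a function over `[-m, m]` is invariant under reflection of the index. -/
theorem sum_Icc_neg_comp_neg {A : Type*} [AddCommMonoid A] (m : ℤ) (f : ℤ → A) :
    ∑ p ∈ Finset.Icc (-m) m, f (-p) = ∑ p ∈ Finset.Icc (-m) m, f p :=
  Finset.sum_nbij' (fun p => -p) (fun p => -p)
    (fun p hp => by simp only [Finset.mem_Icc] at hp ⊢; omega)
    (fun p hp => by simp only [Finset.mem_Icc] at hp ⊢; omega)
    (by simp) (by simp) (by simp)

/-- The symmetric exponential sum with even weights is the corresponding cosine sum. -/
theorem sum_even_mul_exp_eq_sum_mul_cos (m : ℤ) (w : ℤ → ℂ) (hw : ∀ p, w (-p) = w p) (θ : ℂ) :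
    ∑ p ∈ Finset.Icc (-m) m, w p * Complex.exp (p * θ * Complex.I) =
      ∑ p ∈ Finset.Icc (-m) m, w p * Complex.cos (p * θ) := by
  have hreflect := sum_Icc_neg_comp_neg m fun p : ℤ => w p * Complex.exp (p * θ * Complex.I)
  simp only [hw, Int.cast_neg, neg_mul] at hreflect
  simp only [Complex.cos, neg_mul, mul_div_assoc', mul_add, add_div, Finset.sum_add_distrib,
    ← Finset.sum_div, hreflect, add_halves]

/-- Von Neumann amplification factor: the complex exponential grid function
`e_i = e^{i k i Δx}` is an eigenvector of the Forward-Euler update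
`(G y)_i = y_i + Δt (ν ∑_p μ_p y_{i+p} Δx - ν β y_i - (χ/ε) y_i)`
with real amplification factor `ρ = 1 + Δt (M - χ/ε)`, where
`M = ν (∑_p μ_p cos(k p Δx) Δx - β)`. -/
theorem forward_euler_amplification_factor
    (m : ℕ) (μ : ℤ → ℝ) (hμ : ∀ p : ℤ, μ (-p) = μ p)
    (ν β Δx Δt ε χ k : ℝ) (hε : ε ≠ 0)
    (G : (ℤ → ℂ) → (ℤ → ℂ))
    (hG : ∀ (y : ℤ → ℂ) (i : ℤ), G y i =
      y i + (Δt : ℂ) * ((ν : ℂ) * (∑ p ∈ Finset.Icc (-(m : ℤ)) (m : ℤ),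
          (μ p : ℂ) * y (i + p) * (Δx : ℂ))
        - (ν : ℂ) * (β : ℂ) * y i - ((χ / ε : ℝ) : ℂ) * y i))
    (e : ℤ → ℂ) (he : ∀ i : ℤ, e i = Complex.exp (Complex.I * k * ((i : ℝ) * Δx)))
    (M : ℝ) (hM : M = ν * ((∑ p ∈ Finset.Icc (-(m : ℤ)) (m : ℤ),
        μ p * Real.cos (k * ((p : ℝ) * Δx)) * Δx) - β))
    (ρ : ℝ) (hρ : ρ = 1 + Δt * (M - χ / ε)) :
    ∀ i : ℤ, G e i = (ρ : ℂ) * e i := by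
  intro i
  have hshift : ∀ p : ℤ, (μ p : ℂ) * e (i + p) * Δx =
      e i * Δx * (μ p * Complex.exp (p * (k * Δx : ℂ) * Complex.I)) := by
    intro p
    have hexp : e (i + p) = e i * Complex.exp (p * (k * Δx : ℂ) * Complex.I) := by
      rw [he, he, ← Complex.exp_add]
      push_cast
      ring_nf
    rw [hexp]
    ring
  have hcos : ∀ p : ℤ, (μ p : ℂ) * Complex.cos (k * (p * Δx)) * Δx =
      Δx * (μ p * Complex.cos (p * (k * Δx : ℂ))) := by
    intro p
    rw [mul_left_comm (k : ℂ)]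
    ring
  rw [hG, hρ, hM, Finset.sum_congr rfl fun p _ => hshift p, ← Finset.mul_sum,
    sum_even_mul_exp_eq_sum_mul_cos _ (fun p => (μ p : ℂ)) (fun p => by rw [hμ])]
  push_cast
  rw [Finset.sum_congr rfl fun p _ => hcos p, ← Finset.mul_sum]
  ring
end

section
/- (Stability of the penalized Forward-Euler scheme.) Let m ∈ ℕ, let (μ_p)_{p=-m,…,m} be nonnegative real numbers, let Δx > 0, ν > 0, β > 0, ε > 0, let χ ∈ {0, 1}, and let k ∈ ℝ. Suppose the discrete kernel-mass condition ∑_{p=-m}^{m} μ_p·Δx ≤ β holds, and define M = ν·(∑_{p=-m}^{m} μ_p·cos(k·p·Δx)·Δx - β) and the amplification factor ρ = 1 + Δt·(M - χ/ε). Then for every time step Δt with 0 < Δt ≤ 2/(1/ε + 2·ν·β), one has |ρ| ≤ 1. -/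
open Finset

/-- Stability of the penalized Forward-Euler scheme: under the discrete
kernel-mass condition, the amplification factor `ρ = 1 + Δt (M - χ/ε)`
satisfies `|ρ| ≤ 1` for every time step `0 < Δt ≤ 2/(1/ε + 2νβ)`. -/
theorem forward_euler_stability
    (m : ℕ) (μ : ℤ → ℝ) (hμ : ∀ p ∈ Finset.Icc (-(m : ℤ)) (m : ℤ), 0 ≤ μ p)
    (Δx : ℝ) (hΔx : 0 < Δx) (ν : ℝ) (hν : 0 < ν) (β : ℝ) (hβ : 0 < β)
    (ε : ℝ) (hε : 0 < ε) (χ : ℝ) (hχ : χ = 0 ∨ χ = 1) (k : ℝ)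
    (hmass : (∑ p ∈ Finset.Icc (-(m : ℤ)) (m : ℤ), μ p * Δx) ≤ β)
    (M : ℝ) (hM : M = ν * ((∑ p ∈ Finset.Icc (-(m : ℤ)) (m : ℤ),
        μ p * Real.cos (k * ((p : ℝ) * Δx)) * Δx) - β)) :
    ∀ Δt : ℝ, 0 < Δt → Δt ≤ 2 / (1 / ε + 2 * ν * β) →
      |1 + Δt * (M - χ / ε)| ≤ 1 := by
  intro Δt hΔt hle
  have hcos : |∑ p ∈ Finset.Icc (-(m : ℤ)) (m : ℤ),
      μ p * Real.cos (k * ((p : ℝ) * Δx)) * Δx| ≤ β := by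
    refine (Finset.abs_sum_le_sum_abs _ _).trans ((Finset.sum_le_sum fun p hp => ?_).trans hmass)
    rw [abs_mul, abs_mul, abs_of_nonneg (hμ p hp), abs_of_pos hΔx]
    exact mul_le_mul_of_nonneg_right
      (mul_le_of_le_one_right (hμ p hp) (Real.abs_cos_le_one _)) hΔx.le
  obtain ⟨hlow, hup⟩ := abs_le.mp hcos
  have hMup : M ≤ 0 := by
    rw [hM]
    exact mul_nonpos_of_nonneg_of_nonpos hν.le (by linarith)
  have hMlow : -(2 * ν * β) ≤ M := by
    rw [hM]
    nlinarith
  have hε' : 0 < 1 / ε := by positivity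
  have hχε : 0 ≤ χ / ε ∧ χ / ε ≤ 1 / ε := by
    rcases hχ with rfl | rfl
    · simpa using hε.le
    · exact ⟨hε'.le, le_rfl⟩
  have hstep : Δt * (1 / ε + 2 * ν * β) ≤ 2 := (le_div_iff₀ (by positivity)).mp hle
  have hdecay : Δt * (M - χ / ε) ≤ 0 :=
    mul_nonpos_of_nonneg_of_nonpos hΔt.le (by linarith [hχε.1])
  have hbound : Δt * -(1 / ε + 2 * ν * β) ≤ Δt * (M - χ / ε) :=
    mul_le_mul_of_nonneg_left (by linarith [hχε.2]) hΔt.le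
  exact abs_le.mpr ⟨by linarith, by linarith⟩
end
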